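/- arXiv:2502.11260 — 2 statements merged into one kernel-verified Lean document; each statement's English description precedes it below -/
import Mathlib

section
/- Let Q^* be the optimal Q-function of a finite Markov decision process with transition kernel P, reward r : S × A → [0, Rmax] and discount γ ∈ (0,1), i.e., the unique fixed point of the optimal Bellman operator T f(s,a) = r(s,a) + γ E_{s'∼P(·|s,a)} max_{a'} f(s',a'). For any function q : S × A → ℝ and any probability distribution β on S × A, define the probability distribution β''(s',a') = Σ_{(s,a)} β(s,a) P(s'|s,a) · 1{a' = argmax_{a} |Q^*(s',a) − q(s',a)|} (ties broken by a fixed rule). Then ‖Q^* − T q‖_{1,β} ≤ γ · ‖Q^* − q‖_{1,β''}. -/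
open Finset

/-- If `|f - g|` is bounded by `c` on a finite nonempty type, so is the gap between the suprema. -/
theorem abs_ciSup_sub_ciSup_le {A : Type*} [Finite A] [Nonempty A] {f g : A → ℝ} {c : ℝ}
    (h : ∀ a, |f a - g a| ≤ c) : |(⨆ a, f a) - ⨆ a, g a| ≤ c := by
  rw [abs_sub_le_iff, sub_le_iff_le_add, sub_le_iff_le_add]
  constructor
  · refine ciSup_le fun a => ?_
    linarith [(abs_le.1 (h a)).2, le_ciSup (Set.finite_range g).bddAbove a]
  · refine ciSup_le fun a => ?_
    linarith [(abs_le.1 (h a)).1, le_ciSup (Set.finite_range f).bddAbove a]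

/-- For the optimal Q-function `Q*` of a finite MDP and any `q`,
`‖Q* − T q‖_{1,β} ≤ γ‖Q* − q‖_{1,β''}` where `β''` is obtained from `β` by one transition step
followed by the (tie-broken) argmax of `|Q* − q|`. -/
theorem stmt_1
    {S A : Type} [Fintype S] [Fintype A] [Nonempty A] [DecidableEq A]
    (P : S → A → S → ℝ) (hP0 : ∀ s a s', 0 ≤ P s a s') (hP1 : ∀ s a, ∑ s', P s a s' = 1)
    (Rmax : ℝ) (r : S → A → ℝ) (hr : ∀ s a, r s a ∈ Set.Icc (0 : ℝ) Rmax)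
    (γ : ℝ) (hγ : γ ∈ Set.Ioo (0 : ℝ) 1)
    (Qstar : S → A → ℝ)
    -- `Q*` is the (unique) fixed point of the optimal Bellman operator
    (hQstar : ∀ s a, Qstar s a = r s a + γ * ∑ s', P s a s' * ⨆ a', Qstar s' a')
    (q : S → A → ℝ)
    (β : S × A → ℝ) (hβ0 : ∀ x, 0 ≤ β x) (hβ1 : ∑ x, β x = 1)
    -- `amax s'` is a fixed tie-breaking rule selecting an argmax of `|Q*(s',·) − q(s',·)|`
    (amax : S → A)
    (hamax : ∀ s' a, |Qstar s' a - q s' a| ≤ |Qstar s' (amax s') - q s' (amax s')|)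
    (β'' : S × A → ℝ)
    (hβ'' : ∀ x : S × A,
      β'' x = ∑ y : S × A, β y * P y.1 y.2 x.1 * (if x.2 = amax x.1 then 1 else 0)) :
    ∑ x : S × A, β x *
        |Qstar x.1 x.2 - (r x.1 x.2 + γ * ∑ s', P x.1 x.2 s' * ⨆ a', q s' a')|
      ≤ γ * ∑ x : S × A, β'' x * |Qstar x.1 x.2 - q x.1 x.2| := by
  have bellman_gap (x : S × A) :
      |Qstar x.1 x.2 - (r x.1 x.2 + γ * ∑ s', P x.1 x.2 s' * ⨆ a', q s' a')| ≤
        γ * ∑ s', P x.1 x.2 s' * |Qstar s' (amax s') - q s' (amax s')| := by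
    rw [hQstar, add_sub_add_left_eq_sub, ← mul_sub, ← sum_sub_distrib, abs_mul,
      abs_of_pos hγ.1]
    refine mul_le_mul_of_nonneg_left ((abs_sum_le_sum_abs _ _).trans ?_) hγ.1.le
    refine sum_le_sum fun s' _ => ?_
    rw [← mul_sub, abs_mul, abs_of_nonneg (hP0 _ _ _)]
    exact mul_le_mul_of_nonneg_left (abs_ciSup_sub_ciSup_le (hamax s')) (hP0 _ _ _)
  have expand : ∑ x : S × A, β'' x * |Qstar x.1 x.2 - q x.1 x.2| =
      ∑ y : S × A, β y * ∑ s', P y.1 y.2 s' * |Qstar s' (amax s') - q s' (amax s')| := by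
    simp_rw [hβ'', sum_mul, mul_sum]
    rw [sum_comm]
    refine sum_congr rfl fun y _ => ?_
    rw [Fintype.sum_prod_type]
    refine sum_congr rfl fun s' _ => ?_
    simp [mul_assoc]
  rw [expand, mul_sum]
  refine sum_le_sum fun x _ => ?_
  rw [mul_left_comm]
  exact mul_le_mul_of_nonneg_left (bellman_gap x) (hβ0 x)
end

section
/- Consider a finite N-agent Markov game with joint transition kernel P : S × A → Δ(S), per-agent rewards r_i : S × A → [0, Rmax/N] (so r = Σ_i r_i ∈ [0, Rmax]), discount γ ∈ (0,1), and set Vmax = Rmax/(1−γ). Let each agent i have a local transition model P^i : S_{N_i} × A_i → Δ(S_{N_i}) and local reward r̄_i : S_{N_i} × A_i → [0, Rmax/N]. For functions f_i : S_{N_i} × A_i → [0, Vmax] and f(s,a) := Σ_{i=1}^N f_i(s_{N_i}, a_i), let T be the centralized optimal Bellman operator T f(s,a) = r(s,a) + γ E_{s'∼P(·|s,a)} max_{a'} f(s',a') with the maximization over joint actions decomposing as Σ_i max_{a'_i} f_i, and let T̄^i f_i(s_{N_i},a_i) = r̄_i(s_{N_i},a_i) + γ E_{s'_{N_i}∼P^i(·|s_{N_i},a_i)}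 max_{a'_i} f_i(s'_{N_i},a'_i). Then for any probability distribution β on S × A: ‖T f − Σ_i T̄^i f_i‖_{1,β} ≤ Σ_{i=1}^N ( ‖r_i − r̄_i‖_{1,β} + γ·Vmax·‖P − P^i‖_{1,β} ), where ‖r_i − r̄_i‖_{1,β} := E_{(s,a)∼β}|r_i(s,a) − r̄_i(s_{N_i},a_i)| and ‖P − P^i‖_{1,β} := E_{(s,a)∼β} Σ_{s'_{N_i}∈S_{N_i}} | (Σ_{s': proj_{N_i}(s')=s'_{N_i}} P(s'|s,a)) − P^i(s'_{N_i}|s_{N_i},a_i) |. -/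
open Finset

/-- Local state space of agent `i`. -/
abbrev LocalState {N : ℕ} (S : Fin N → Type) (Nbr : Fin N → Finset (Fin N)) (i : Fin N) : Type :=
  (j : {j // j ∈ Nbr i}) → S j.1

/-- Projection of a joint state onto the neighborhood of agent `i`. -/
def projState {N : ℕ} {S : Fin N → Type} (Nbr : Fin N → Finset (Fin N)) (i : Fin N)
    (s : ∀ j, S j) : LocalState S Nbr i := fun j => s j.1

/-- Expectations of a function with values in `[0, V]` under a pushforward weight and another weight
differ by at most `V` times the `ℓ¹` distance of the weights. -/
theorem abs_sum_mul_comp_sub_sum_mul_le {X Y : Type*} [Fintype X] [Fintype Y] [DecidableEq Y]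
    (π : X → Y) (p : X → ℝ) (q g : Y → ℝ) {V : ℝ} (hg : ∀ y, g y ∈ Set.Icc 0 V) :
    |∑ x, p x * g (π x) - ∑ y, q y * g y| ≤
      V * ∑ y, |(∑ x, if π x = y then p x else 0) - q y| := by
  have hpush : ∑ x, p x * g (π x) = ∑ y, (∑ x, if π x = y then p x else 0) * g y := by
    simp_rw [Finset.sum_mul, ite_mul, zero_mul]
    rw [Finset.sum_comm]
    simp
  rw [hpush, ← Finset.sum_sub_distrib, Finset.mul_sum]
  refine (Finset.abs_sum_le_sum_abs _ _).trans (Finset.sum_le_sum fun y _ => ?_)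
  rw [← sub_mul, abs_mul, abs_of_nonneg (hg y).1, mul_comm]
  exact mul_le_mul_of_nonneg_right (hg y).2 (abs_nonneg _)

/-- The gap between the centralized optimal Bellman operator applied to a
sum-decomposable `f = ∑ i f_i` and the sum of the decentralized operators `T̄^i f_i` is bounded,
in `‖·‖_{1,β}`, by the sum of the per-agent reward errors plus `γ·Vmax` times the per-agent
transition-marginal errors. -/
theorem stmt_2
    {N : ℕ} (S A : Fin N → Type) [∀ j, Fintype (S j)] [∀ j, Fintype (A j)]
    [∀ j, DecidableEq (S j)] [∀ j, Nonempty (A j)]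
    (Nbr : Fin N → Finset (Fin N))
    (P : (∀ j, S j) → (∀ j, A j) → (∀ j, S j) → ℝ)
    (hP0 : ∀ s a s', 0 ≤ P s a s') (hP1 : ∀ s a, ∑ s', P s a s' = 1)
    (Rmax : ℝ) (hRmax : 0 ≤ Rmax)
    (ri : ∀ _ : Fin N, (∀ j, S j) → (∀ j, A j) → ℝ)
    (hri : ∀ i s a, ri i s a ∈ Set.Icc (0 : ℝ) (Rmax / N))
    (γ : ℝ) (hγ : γ ∈ Set.Ioo (0 : ℝ) 1)
    (Vmax : ℝ) (hVmax : Vmax = Rmax / (1 - γ))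
    (Ploc : ∀ i : Fin N, LocalState S Nbr i → A i → LocalState S Nbr i → ℝ)
    (hPloc0 : ∀ i t b t', 0 ≤ Ploc i t b t') (hPloc1 : ∀ i t b, ∑ t', Ploc i t b t' = 1)
    (rbar : ∀ i : Fin N, LocalState S Nbr i → A i → ℝ)
    (hrbar : ∀ i t b, rbar i t b ∈ Set.Icc (0 : ℝ) (Rmax / N))
    (f : ∀ i : Fin N, LocalState S Nbr i × A i → ℝ)
    (hf : ∀ i x, f i x ∈ Set.Icc (0 : ℝ) Vmax)
    (β : ((∀ j, S j) × (∀ j, A j)) → ℝ) (hβ0 : ∀ x, 0 ≤ β x) (hβ1 : ∑ x, β x = 1) :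
    -- ‖T f − ∑ i T̄^i f_i‖_{1,β}
    ∑ x : (∀ j, S j) × (∀ j, A j), β x *
        |((∑ i, ri i x.1 x.2) + γ * ∑ s', P x.1 x.2 s' *
            ∑ i, ⨆ b : A i, f i (projState Nbr i s', b))
          - ∑ i, (rbar i (projState Nbr i x.1) (x.2 i) + γ *
              ∑ t', Ploc i (projState Nbr i x.1) (x.2 i) t' * ⨆ b : A i, f i (t', b))|
      ≤ ∑ i,
          ((∑ x : (∀ j, S j) × (∀ j, A j), β x *
              |ri i x.1 x.2 - rbar i (projState Nbr i x.1) (x.2 i)|)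
            + γ * Vmax * ∑ x : (∀ j, S j) × (∀ j, A j), β x *
                ∑ t' : LocalState S Nbr i,
                  |(∑ s', if projState Nbr i s' = t' then P x.1 x.2 s' else 0)
                    - Ploc i (projState Nbr i x.1) (x.2 i) t'|) := by
  have hg : ∀ i t, (⨆ b : A i, f i (t, b)) ∈ Set.Icc 0 Vmax := fun i t =>
    ⟨Real.iSup_nonneg fun b => (hf i (t, b)).1, ciSup_le fun b => (hf i (t, b)).2⟩
  have hsplit : ∀ x : (∀ j, S j) × (∀ j, A j),
      ((∑ i, ri i x.1 x.2) + γ * ∑ s', P x.1 x.2 s' *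
            ∑ i, ⨆ b : A i, f i (projState Nbr i s', b))
          - ∑ i, (rbar i (projState Nbr i x.1) (x.2 i) + γ *
              ∑ t', Ploc i (projState Nbr i x.1) (x.2 i) t' * ⨆ b : A i, f i (t', b)) =
      ∑ i, ((ri i x.1 x.2 - rbar i (projState Nbr i x.1) (x.2 i)) + γ *
        (∑ s', P x.1 x.2 s' * (⨆ b : A i, f i (projState Nbr i s', b)) -
          ∑ t', Ploc i (projState Nbr i x.1) (x.2 i) t' * ⨆ b : A i, f i (t', b))) := by
    intro x
    have hcomm : ∑ s', P x.1 x.2 s' * ∑ i, ⨆ b : A i, f i (projState Nbr i s', b) =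
        ∑ i, ∑ s', P x.1 x.2 s' * ⨆ b : A i, f i (projState Nbr i s', b) := by
      simp_rw [Finset.mul_sum]
      exact Finset.sum_comm
    rw [hcomm]
    simp only [Finset.sum_add_distrib, Finset.sum_sub_distrib, ← Finset.mul_sum]
    ring
  have hbound : ∀ x : (∀ j, S j) × (∀ j, A j), ∀ i,
      |(ri i x.1 x.2 - rbar i (projState Nbr i x.1) (x.2 i)) + γ *
        (∑ s', P x.1 x.2 s' * (⨆ b : A i, f i (projState Nbr i s', b)) -
          ∑ t', Ploc i (projState Nbr i x.1) (x.2 i) t' * ⨆ b : A i, f i (t', b))| ≤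
      |ri i x.1 x.2 - rbar i (projState Nbr i x.1) (x.2 i)| + γ * (Vmax *
        ∑ t' : LocalState S Nbr i,
          |(∑ s', if projState Nbr i s' = t' then P x.1 x.2 s' else 0)
            - Ploc i (projState Nbr i x.1) (x.2 i) t'|) := by
    intro x i
    refine (abs_add_le _ _).trans (add_le_add le_rfl ?_)
    rw [abs_mul, abs_of_pos hγ.1]
    exact mul_le_mul_of_nonneg_left
      (abs_sum_mul_comp_sub_sum_mul_le (projState Nbr i) (P x.1 x.2) _ _ (hg i)) hγ.1.le
  calc _ ≤ ∑ x : (∀ j, S j) × (∀ j, A j), ∑ i, β x *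
        (|ri i x.1 x.2 - rbar i (projState Nbr i x.1) (x.2 i)| + γ * (Vmax *
        ∑ t' : LocalState S Nbr i,
          |(∑ s', if projState Nbr i s' = t' then P x.1 x.2 s' else 0)
            - Ploc i (projState Nbr i x.1) (x.2 i) t'|)) := by
        refine Finset.sum_le_sum fun x _ => ?_
        rw [hsplit x, ← Finset.mul_sum]
        exact mul_le_mul_of_nonneg_left ((Finset.abs_sum_le_sum_abs _ _).trans
          (Finset.sum_le_sum fun i _ => hbound x i)) (hβ0 x)
    _ = _ := by
        rw [Finset.sum_comm]
        refine Finset.sum_congr rfl fun i _ => ?_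
        rw [Finset.mul_sum, ← Finset.sum_add_distrib]
        exact Finset.sum_congr rfl fun x _ => by ring
end
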